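/- arXiv:2411.01906 — 3 statements merged into one kernel-verified Lean document; each statement's English description precedes it below -/
import Mathlib

section
/- Let λ > 0 and 0 < R ≤ l be real numbers. Then ∫₀^R 2πλ u e^{−πλu²} e^{−√(l²−u²)/2} du = e^{−l/2} − e^{−πλR² − √(l²−R²)/2} + (1/2) e^{−πλl² − 1/(16πλ)} · S(√(l²−R²), l), where S(a,b) = Σ_{n=0}^∞ (πλ)ⁿ/(n!(2n+1)) · ((b − 1/(4πλ))^{2n+1} − (a − 1/(4πλ))^{2n+1}). -/
open Real MeasureTheory

/-- Termwise integration of the Taylor series of `s ↦ exp (k * s ^ 2)`. -/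
theorem hasSum_integral_exp_mul_sq (k : ℝ) (a b : ℝ) :
    HasSum (fun n : ℕ => k ^ n / ((n.factorial : ℝ) * (2 * n + 1)) *
      (b ^ (2 * n + 1) - a ^ (2 * n + 1))) (∫ s in a..b, Real.exp (k * s ^ 2)) := by
  have hexp (x : ℝ) : HasSum (fun n : ℕ => x ^ n / (n.factorial : ℝ)) (Real.exp x) := by
    rw [Real.exp_eq_exp_ℝ]
    exact NormedSpace.expSeries_div_hasSum_exp x
  have hsum := intervalIntegral.hasSum_integral_of_dominated_convergence
    (μ := volume) (a := a) (b := b)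
    (F := fun (n : ℕ) (s : ℝ) => (k * s ^ 2) ^ n / (n.factorial : ℝ))
    (f := fun s => Real.exp (k * s ^ 2))
    (fun (n : ℕ) (s : ℝ) => |k * s ^ 2| ^ n / (n.factorial : ℝ))
    (fun n => Continuous.aestronglyMeasurable (by fun_prop))
    (fun n => .of_forall fun s _ => by simp)
    (.of_forall fun s _ => (hexp _).summable)
    (by
      simp_rw [fun s : ℝ => (hexp |k * s ^ 2|).tsum_eq]
      exact Continuous.intervalIntegrable (by fun_prop) _ _)
    (.of_forall fun s _ => hexp _)
  refine (congrArg (HasSum · _) ?_).mpr hsum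
  funext n
  have hpow (s : ℝ) : (k * s ^ 2) ^ n / (n.factorial : ℝ) =
      k ^ n / (n.factorial : ℝ) * s ^ (2 * n) := by
    rw [mul_pow, ← pow_mul]; ring
  simp_rw [hpow]
  rw [intervalIntegral.integral_const_mul, integral_pow]
  have := n.factorial_ne_zero
  push_cast
  field_simp

theorem stmt_2 (lam R l : ℝ) (hlam : 0 < lam) (hR : 0 < R) (hRl : R ≤ l) :
    ∫ u in (0:ℝ)..R,
        2 * π * lam * u * Real.exp (-(π * lam * u ^ 2)) *
          Real.exp (-(Real.sqrt (l ^ 2 - u ^ 2) / 2)) =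
      Real.exp (-(l / 2))
        - Real.exp (-(π * lam * R ^ 2) - Real.sqrt (l ^ 2 - R ^ 2) / 2)
        + (1 / 2) * Real.exp (-(π * lam * l ^ 2) - 1 / (16 * π * lam)) *
            ∑' n : ℕ, (π * lam) ^ n / ((n.factorial : ℝ) * (2 * n + 1)) *
              ((l - 1 / (4 * π * lam)) ^ (2 * n + 1)
                - (Real.sqrt (l ^ 2 - R ^ 2) - 1 / (4 * π * lam)) ^ (2 * n + 1)) := by
  rw [(hasSum_integral_exp_mul_sq (π * lam) _ _).tsum_eq]
  have hπ := Real.pi_pos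
  set c := 1 / (4 * π * lam) with hc
  set C := Real.exp (-(π * lam * l ^ 2) - 1 / (16 * π * lam)) with hC
  have hcont : Continuous fun s : ℝ => Real.exp (π * lam * s ^ 2) := by fun_prop
  have hE (x : ℝ) : HasDerivAt (fun x => ∫ s in (l - c)..x, Real.exp (π * lam * s ^ 2))
      (Real.exp (π * lam * x ^ 2)) x :=
    intervalIntegral.integral_hasDerivAt_right (hcont.intervalIntegrable _ _)
      (hcont.stronglyMeasurableAtFilter _ _) hcont.continuousAt
  have hEc : Continuous fun x => ∫ s in (l - c)..x, Real.exp (π * lam * s ^ 2) :=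
    continuous_iff_continuousAt.2 fun x => (hE x).continuousAt
  have key := intervalIntegral.integral_eq_sub_of_hasDerivAt_of_le hR.le
    (f := fun u => -Real.exp (-(π * lam * u ^ 2) - Real.sqrt (l ^ 2 - u ^ 2) / 2)
      - (1 / 2) * C * ∫ s in (l - c)..(Real.sqrt (l ^ 2 - u ^ 2) - c),
          Real.exp (π * lam * s ^ 2))
    (f' := fun u => 2 * π * lam * u * Real.exp (-(π * lam * u ^ 2)) *
          Real.exp (-(Real.sqrt (l ^ 2 - u ^ 2) / 2)))
    (by
      refine Continuous.continuousOn (.sub (by fun_prop) (continuous_const.mul ?_))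
      exact hEc.comp (by fun_prop : Continuous fun u : ℝ => Real.sqrt (l ^ 2 - u ^ 2) - c))
    (by
      intro u hu
      have hpos : 0 < l ^ 2 - u ^ 2 := by nlinarith [hu.1, hu.2]
      have hsq : HasDerivAt (fun u : ℝ => u ^ 2) (2 * u) u := by
        simpa using hasDerivAt_pow 2 u
      have ht := (hsq.const_sub (l ^ 2)).sqrt hpos.ne'
      have h1 := (((hsq.const_mul (π * lam)).neg).sub (ht.div_const 2)).exp.neg
      have h2 := ((hE _).comp u (ht.sub_const c)).const_mul ((1 / 2) * C)
      refine (h1.sub h2).congr_deriv ?_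
      have hCe : C * Real.exp (π * lam * (Real.sqrt (l ^ 2 - u ^ 2) - c) ^ 2) =
          Real.exp (-(π * lam * u ^ 2) - Real.sqrt (l ^ 2 - u ^ 2) / 2) := by
        rw [hC, ← Real.exp_add]
        congr 1
        have hs := Real.sq_sqrt hpos.le
        have hcc : π * lam * c = 1 / 4 := by rw [hc]; field_simp
        have hcc' : 1 / (16 * π * lam) = c / 4 := by rw [hc]; field_simp; norm_num
        rw [hcc']
        linear_combination (π * lam) * hs + (c - 2 * Real.sqrt (l ^ 2 - u ^ 2)) * hcc
      rw [mul_assoc (2 * π * lam * u), ← Real.exp_add, ← sub_eq_add_neg]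
      simp only [Pi.neg_apply, Pi.sub_apply]
      linear_combination (-(1 / 2) * (-(2 * u) / (2 * Real.sqrt (l ^ 2 - u ^ 2)))) * hCe)
    (Continuous.intervalIntegrable (by fun_prop) _ _)
  rw [key, intervalIntegral.integral_symm (l - c)]
  have h0 : Real.sqrt (l ^ 2 - 0 ^ 2) = l := by
    rw [zero_pow two_ne_zero, sub_zero, Real.sqrt_sq (hR.le.trans hRl)]
  rw [h0, intervalIntegral.integral_same]
  simp only [zero_pow two_ne_zero, mul_zero, neg_zero, zero_sub]
  ring
end

section
/- Let R > 0, m ≥ 0 and l be real numbers with l² ≥ R² + m². Then ∫₀^R (2u/R²) (∫_{m}^{√(l²−u²)} (2/5)(v/15)⁵ e^{−(v/15)⁶} dv) du = e^{−(m/15)⁶} − (1/R²) Σ_{n=0}^∞ (−1)ⁿ/(n! · 15^{6n} · (3n+1)) · ((l²)^{3n+1} − (l² − R²)^{3n+1}). -/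
open Real MeasureTheory

/-- The Weibull density with shape `6` and scale `15` integrates to a difference of tails. -/
theorem integral_weibull_six_fifteen (a b : ℝ) :
    ∫ v in a..b, (2 / 5) * (v / 15) ^ 5 * Real.exp (-((v / 15) ^ 6)) =
      Real.exp (-((a / 15) ^ 6)) - Real.exp (-((b / 15) ^ 6)) := by
  have hderiv (v : ℝ) : HasDerivAt (fun v : ℝ => -Real.exp (-((v / 15) ^ 6)))
      ((2 / 5) * (v / 15) ^ 5 * Real.exp (-((v / 15) ^ 6))) v :=
    ((((hasDerivAt_id' v).div_const 15).pow 6).neg.exp).neg.congr_deriv (by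
      norm_num
      ring)
  rw [intervalIntegral.integral_eq_sub_of_hasDerivAt (fun v _ => hderiv v)
    (Continuous.intervalIntegrable (by fun_prop) _ _)]
  ring

/-- Termwise integration of the power series of `w ↦ exp (-(w ^ k / c))`. -/
theorem hasSum_integral_exp_neg_pow_div (k : ℕ) (c a b : ℝ) :
    HasSum (fun n : ℕ => (-1 : ℝ) ^ n / ((n.factorial : ℝ) * c ^ n * (k * n + 1)) *
        (b ^ (k * n + 1) - a ^ (k * n + 1)))
      (∫ w in a..b, Real.exp (-(w ^ k / c))) := by
  obtain ⟨M, hM⟩ := isCompact_uIcc.exists_bound_of_continuousOn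
    (s := Set.uIcc a b) (f := fun w : ℝ => -(w ^ k / c)) (by fun_prop)
  have hsum := intervalIntegral.hasSum_integral_of_dominated_convergence
    (μ := volume) (a := a) (b := b) (F := fun (n : ℕ) (w : ℝ) => (-(w ^ k / c)) ^ n / n.factorial)
    (f := fun w => Real.exp (-(w ^ k / c)))
    (fun n _ => M ^ n / n.factorial)
    (fun n => (Continuous.aestronglyMeasurable (by fun_prop)))
    (fun n => .of_forall fun w hw => by
      rw [norm_div, norm_pow, RCLike.norm_natCast]
      gcongr
      exact hM w (Set.uIoc_subset_uIcc hw))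
    (.of_forall fun _ _ => Real.summable_pow_div_factorial M)
    intervalIntegrable_const
    (.of_forall fun w _ => by
      rw [Real.exp_eq_exp_ℝ]
      exact NormedSpace.expSeries_div_hasSum_exp _)
  have hint (n : ℕ) : ∫ w in a..b, (-(w ^ k / c)) ^ n / n.factorial =
      (-1 : ℝ) ^ n / (n.factorial * c ^ n * (k * n + 1)) *
        (b ^ (k * n + 1) - a ^ (k * n + 1)) := by
    have hterm (w : ℝ) : (-(w ^ k / c)) ^ n / n.factorial =
        (-1) ^ n / (n.factorial * c ^ n) * w ^ (k * n) := by
      rw [neg_pow, div_pow, ← pow_mul]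
      field_simp
    simp_rw [hterm]
    rw [intervalIntegral.integral_const_mul, integral_pow]
    push_cast
    rw [div_mul_div_comm, div_mul_eq_mul_div]
  simpa only [hint] using hsum

/-- The substitution `w = s - u ^ 2`. -/
theorem integral_two_mul_comp_sub_sq {g : ℝ → ℝ} (hg : Continuous g) (s R : ℝ) :
    ∫ u in (0 : ℝ)..R, 2 * u * g (s - u ^ 2) = ∫ w in (s - R ^ 2)..s, g w := by
  have hderiv (u : ℝ) : HasDerivAt (fun u : ℝ => s - u ^ 2) (-(2 * u)) u := by
    simpa using (hasDerivAt_pow 2 u).const_sub s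
  have hsubst := intervalIntegral.integral_comp_mul_deriv (a := 0) (b := R)
    (fun u _ => hderiv u) (by fun_prop) hg
  rw [intervalIntegral.integral_symm s (s - R ^ 2)]
  simp only [ne_eq, OfNat.ofNat_ne_zero, not_false_eq_true, zero_pow, sub_zero] at hsubst
  rw [← hsubst, ← intervalIntegral.integral_neg]
  congr with u
  simp only [Function.comp_apply]
  ring

theorem stmt_8 (R m l : ℝ) (hR : 0 < R) (hm : 0 ≤ m) (hl : R ^ 2 + m ^ 2 ≤ l ^ 2) :
    ∫ u in (0:ℝ)..R,
        (2 * u / R ^ 2) *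
          ∫ v in m..(Real.sqrt (l ^ 2 - u ^ 2)),
            (2 / 5) * (v / 15) ^ 5 * Real.exp (-((v / 15) ^ 6)) =
      Real.exp (-((m / 15) ^ 6))
        - (1 / R ^ 2) *
            ∑' n : ℕ, (-1 : ℝ) ^ n / ((n.factorial : ℝ) * 15 ^ (6 * n) * (3 * n + 1)) *
              ((l ^ 2) ^ (3 * n + 1) - (l ^ 2 - R ^ 2) ^ (3 * n + 1)) := by
  have hseries := (hasSum_integral_exp_neg_pow_div 3 (15 ^ 6) (l ^ 2 - R ^ 2) (l ^ 2)).tsum_eq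
  simp only [← pow_mul, Nat.cast_ofNat] at hseries
  simp only [← pow_mul]
  rw [hseries, ← integral_two_mul_comp_sub_sq (by fun_prop)]
  have hinner : Set.EqOn
      (fun u : ℝ => (2 * u / R ^ 2) * ∫ v in m..(Real.sqrt (l ^ 2 - u ^ 2)),
        (2 / 5) * (v / 15) ^ 5 * Real.exp (-((v / 15) ^ 6)))
      (fun u => (2 * Real.exp (-((m / 15) ^ 6)) / R ^ 2) * u -
        (1 / R ^ 2) * (2 * u * Real.exp (-((l ^ 2 - u ^ 2) ^ 3 / 15 ^ 6)))) (Set.uIcc 0 R) := by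
    intro u hu
    rw [Set.uIcc_of_le hR.le] at hu
    have hnonneg : 0 ≤ l ^ 2 - u ^ 2 := by nlinarith [hu.1, hu.2, sq_nonneg m]
    have hpow : (Real.sqrt (l ^ 2 - u ^ 2) / 15) ^ 6 = (l ^ 2 - u ^ 2) ^ 3 / 15 ^ 6 := by
      rw [div_pow, show 6 = 2 * 3 from rfl, pow_mul, Real.sq_sqrt hnonneg]
    simp only [integral_weibull_six_fifteen, hpow]
    ring
  rw [intervalIntegral.integral_congr hinner, intervalIntegral.integral_sub
    (Continuous.intervalIntegrable (by fun_prop) _ _)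
    (Continuous.intervalIntegrable (by fun_prop) _ _),
    intervalIntegral.integral_const_mul, intervalIntegral.integral_const_mul, integral_id]
  field_simp
  ring
end

section
/- Let R ≥ 0 and m ≥ 0 be real numbers and define G(l) = ∫₀^{R²} (e^{−(m/15)⁶} − e^{−(l²−t)³/15⁶}) dt for l ∈ ℝ. Then for every real l, G is differentiable at l with G′(l) = 2l · (e^{−(l²−R²)³/15⁶} − e^{−(l/15)⁶}). -/
theorem Continuous.hasDerivAt_integral_comp_sub {φ : ℝ → ℝ} (hφ : Continuous φ) (a b y : ℝ) :
    HasDerivAt (fun y : ℝ => ∫ t in a..b, φ (y - t)) (φ (y - a) - φ (y - b)) y := by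
  have primitive (c : ℝ) : HasDerivAt (fun y : ℝ => ∫ u in (0:ℝ)..(y - c), φ u) (φ (y - c)) y :=
    (hφ.integral_hasStrictDerivAt 0 (y - c)).hasDerivAt.comp_sub_const y c
  refine ((primitive a).sub (primitive b)).congr_of_eventuallyEq (.of_forall fun z => ?_)
  refine (intervalIntegral.integral_comp_sub_left φ z).trans ?_
  exact (intervalIntegral.integral_interval_sub_left (hφ.intervalIntegrable _ _)
    (hφ.intervalIntegrable _ _)).symm

theorem stmt_9 (R m : ℝ) (hR : 0 ≤ R) (hm : 0 ≤ m) :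
    ∀ l : ℝ,
      HasDerivAt
        (fun x : ℝ => ∫ t in (0:ℝ)..(R ^ 2),
          (Real.exp (-((m / 15) ^ 6)) - Real.exp (-((x ^ 2 - t) ^ 3 / 15 ^ 6))))
        (2 * l * (Real.exp (-((l ^ 2 - R ^ 2) ^ 3 / 15 ^ 6)) - Real.exp (-((l / 15) ^ 6)))) l := by
  intro l
  have hψ : Continuous fun u : ℝ =>
      Real.exp (-((m / 15) ^ 6)) - Real.exp (-(u ^ 3 / 15 ^ 6)) := by
    fun_prop
  have h := (hψ.hasDerivAt_integral_comp_sub 0 (R ^ 2) (l ^ 2)).comp l (hasDerivAt_pow 2 l)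
  refine h.congr_deriv ?_
  have hpow : (l / 15) ^ 6 = (l ^ 2 - 0) ^ 3 / 15 ^ 6 := by ring
  rw [hpow]
  push_cast
  ring
end
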